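/- Let C be an (n,k)_q MDS code containing the zero word 0̄, with n = q + k - 1, k > 2, and q > 2. Then C contains a codeword of full weight n; that is, n ∈ W(C). -/

import Mathlib

/-- `C ⊆ A^n` is an `(n,k)_q` MDS code: it has `q^k` codewords and its minimum
Hamming distance equals `n - k + 1`. -/
def IsMDS {A : Type*} [DecidableEq A] {n : ℕ} (q k : ℕ) (C : Finset (Fin n → A)) : Prop :=
  C.card = q ^ k ∧
    (∀ x ∈ C, ∀ y ∈ C, x ≠ y → n - k + 1 ≤ hammingDist x y) ∧
    (∃ x ∈ C, ∃ y ∈ C, x ≠ y ∧ hammingDist x y = n - k + 1)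

/-- The Hamming weight of a word `c : Fin n → A` relative to a distinguished
zero element `z` of the alphabet: the number of coordinates different from `z`. -/
def wt {A : Type*} [DecidableEq A] {n : ℕ} (z : A) (c : Fin n → A) : ℕ :=
  (Finset.univ.filter fun i => c i ≠ z).card

/-- Two codes are equivalent if one is obtained from the other by a permutation
`σ` of the coordinate positions together with a permutation `π i` of the alphabet
applied in each position `i`. -/
def CodeEquiv {A : Type*} [DecidableEq A] {n : ℕ} (C C' : Finset (Fin n → A)) : Prop :=
  ∃ (σ : Equiv.Perm (Fin n)) (π : Fin n → Equiv.Perm A),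
    C' = C.image fun c => fun i => π i (c (σ i))

open Finset

/-- Two codewords of an MDS code that agree on at least `k` positions are equal. -/
theorem IsMDS.eq_of_agree {A : Type*} [DecidableEq A] {n q k : ℕ}
    {C : Finset (Fin n → A)} (hC : IsMDS q k C) {K : Finset (Fin n)} (hK : k ≤ K.card)
    {x y : Fin n → A} (hx : x ∈ C) (hy : y ∈ C) (h : ∀ i ∈ K, x i = y i) : x = y := by
  by_contra hne
  have hdist := hC.2.1 x hx y hy hne
  have hsub : hammingDist x y ≤ Kᶜ.card := by
    refine card_le_card fun i hi => ?_
    rw [mem_compl]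
    exact fun hiK => (mem_filter.1 hi).2 (h i hiK)
  rw [card_compl, Fintype.card_fin] at hsub
  omega

/-- Any `k` positions of an MDS code can be prescribed arbitrarily. -/
theorem IsMDS.exists_agree {A : Type*} [Fintype A] [DecidableEq A] {n k : ℕ}
    {C : Finset (Fin n → A)} (hC : IsMDS (Fintype.card A) k C)
    {K : Finset (Fin n)} (hK : K.card = k) (f : Fin n → A) :
    ∃ c ∈ C, ∀ i ∈ K, c i = f i := by
  let restr : C → (K → A) := fun c i => c.1 i
  have hinj : Function.Injective restr := fun x y hxy =>
    Subtype.ext (hC.eq_of_agree hK.ge x.2 y.2 fun i hi => congrFun hxy ⟨i, hi⟩)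
  have hbij : Function.Bijective restr := by
    rw [Fintype.bijective_iff_injective_and_card]
    exact ⟨hinj, by simp [hC.1, hK]⟩
  obtain ⟨c, hc⟩ := hbij.2 fun i => f i
  exact ⟨c, c.2, fun i hi => congrFun hc ⟨i, hi⟩⟩

/-- In an MDS code of length `q + k - 1`, if no codeword is nowhere zero, then every nowhere zero
word on `k - 2` positions extends by zeros to a codeword. -/
theorem IsMDS.exists_extend_by_zero {A : Type*} [Fintype A] [DecidableEq A] {n k : ℕ}
    {C : Finset (Fin n → A)} (hC : IsMDS (Fintype.card A) k C) (z : A)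
    (hA : 0 < Fintype.card A) {P : Finset (Fin n)} (hk : k = P.card + 2)
    (hn : n = Fintype.card A + P.card + 1) (hzero : ∀ c ∈ C, ∃ i, c i = z)
    (a : Fin n → A) (ha : ∀ p ∈ P, a p ≠ z) :
    ∃ c ∈ C, (∀ p ∈ P, c p = a p) ∧ ∀ r ∉ P, c r = z := by
  have hcompl : Pᶜ.card = Fintype.card A + 1 := by
    rw [card_compl, Fintype.card_fin]; omega
  have hcard {r s : Fin n} (hr : r ∉ P) (hs : s ∉ P) (hrs : r ≠ s) :
      (insert r (insert s P)).card = k := by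
    rw [card_insert_of_notMem (by simp [hr, hrs]), card_insert_of_notMem hs, hk]
  obtain ⟨i, hi, j, hj, hij⟩ := one_lt_card.1 (by omega : 1 < Pᶜ.card)
  rw [mem_compl] at hi hj
  obtain ⟨c, hcC, hc⟩ := hC.exists_agree (hcard hi hj hij) fun x => if x ∈ P then a x else z
  have hcP : ∀ p ∈ P, c p = a p := fun p hp => by
    rw [hc p (by simp [hp]), if_pos hp]
  have hci : c i = z := by rw [hc i (by simp), if_neg hi]
  have hcj : c j = z := by rw [hc j (by simp), if_neg hj]
  refine ⟨c, hcC, hcP, fun m hm => ?_⟩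
  by_contra hcm
  have hmi : m ≠ i := fun h => hcm (h ▸ hci)
  have hmj : m ≠ j := fun h => hcm (h ▸ hcj)
  -- For each `r`, the codeword agreeing with `c` on `P` and at `m`, and vanishing at `r`.
  have hw : ∀ r, ∃ w : Fin n → A, r ∉ P → r ≠ m →
      w ∈ C ∧ (∀ p ∈ P, w p = c p) ∧ w m = c m ∧ w r = z := fun r => by
    by_cases hr : r ∉ P ∧ r ≠ m
    · obtain ⟨w, hwC, hw⟩ :=
        hC.exists_agree (hcard hr.1 hm hr.2) fun x => if x = r then z else c x
      refine ⟨w, fun _ _ => ⟨hwC, fun p hp => ?_, ?_, ?_⟩⟩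
      · rw [hw p (by simp [hp]), if_neg fun h : p = r => hr.1 (h ▸ hp)]
      · rw [hw m (by simp), if_neg hr.2.symm]
      · rw [hw r (by simp), if_pos rfl]
    · exact ⟨c, fun h h' => (hr ⟨h, h'⟩).elim⟩
  choose w hw using hw
  have hcover : (univ : Finset A) ⊆ ((Pᶜ.erase m).erase j).image fun r => w r i := fun x _ => by
    obtain ⟨v, hvC, hv⟩ :=
      hC.exists_agree (hcard hi hm hmi.symm) fun y => if y = i then x else c y
    have hvi : v i = x := by rw [hv i (by simp), if_pos rfl]
    have hvm : v m = c m := by rw [hv m (by simp), if_neg hmi]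
    have hvP : ∀ p ∈ P, v p = c p := fun p hp => by
      rw [hv p (by simp [hp]), if_neg fun h : p = i => hi (h ▸ hp)]
    have key {r : Fin n} (hr : r ∉ P) (hrm : r ≠ m) {u u' : Fin n → A} (hu : u ∈ C)
        (hu' : u' ∈ C) (hP : ∀ p ∈ P, u p = u' p) (hum : u m = u' m) (hur : u r = u' r) :
        u = u' := by
      refine hC.eq_of_agree (hcard hr hm hrm).ge hu hu' fun y hy => ?_
      rcases mem_insert.1 hy with rfl | hy
      · exact hur
      · rcases mem_insert.1 hy with rfl | hy
        · exact hum
        · exact hP y hy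
    obtain ⟨r, hr⟩ := hzero v hvC
    have hrP : r ∉ P := fun h => ha r h (by rw [← hcP r h, ← hvP r h, hr])
    have hrm : r ≠ m := fun h => hcm (by rw [← hvm, ← h, hr])
    have hwv {s : Fin n} (hs : s ∉ P) (hsm : s ≠ m) (hvs : v s = z) : w s = v := by
      obtain ⟨h1, h2, h3, h4⟩ := hw s hs hsm
      exact key hs hsm h1 hvC (fun p hp => by rw [h2 p hp, hvP p hp]) (by rw [h3, hvm])
        (by rw [h4, hvs])
    rw [mem_image]
    by_cases hrj : r = j
    · have hvc : v = c := key hj hmj.symm hvC hcC hvP hvm (by rw [← hrj, hr, hrj, hcj])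
      refine ⟨i, by simp [hij, hmi.symm, hi], ?_⟩
      rw [hwv hi hmi.symm (by rw [hvc, hci]), hvi]
    · exact ⟨r, by simp [hrj, hrm, hrP], by rw [hwv hrP hrm hr, hvi]⟩
  have hle := (card_le_card hcover).trans card_image_le
  rw [card_univ, card_erase_of_mem (by simp [hj, hmj.symm]),
    card_erase_of_mem (by simpa using hm), hcompl] at hle
  omega

/-- an `(n,k)_q` MDS code containing the zero word, with
`n = q + k - 1`, `k > 2` and `q > 2`, contains a codeword of full weight `n`. -/
theorem stmt_8 {A : Type*} [Fintype A] [DecidableEq A] {q n k : ℕ}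
    (hA : Fintype.card A = q) (z : A)
    (C : Finset (Fin n → A)) (hC : IsMDS q k C)
    (h0 : (fun _ : Fin n => z) ∈ C)
    (hn : n = q + k - 1) (hk : 2 < k) (hq : 2 < q) :
    ∃ c ∈ C, wt z c = n := by
  subst hA
  by_contra! hfull
  have hzero : ∀ c ∈ C, ∃ i, c i = z := fun c hc => by
    by_contra! hne
    exact hfull c hc (by simp [wt, hne])
  obtain ⟨P, -, hP⟩ := exists_subset_card_eq
    (show k - 2 ≤ (univ : Finset (Fin n)).card by rw [card_univ, Fintype.card_fin]; omega)
  obtain ⟨p, hp⟩ := card_pos.1 (by omega : 0 < P.card)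
  obtain ⟨b, b', hb, hb', hbb'⟩ : ∃ b b' : A, b ≠ z ∧ b' ≠ z ∧ b ≠ b' := by
    have hcard : 1 < (univ.erase z).card := by
      rw [card_erase_of_mem (mem_univ z), card_univ]; omega
    obtain ⟨b, hb, b', hb', hne⟩ := one_lt_card.1 hcard
    exact ⟨b, b', ne_of_mem_erase hb, ne_of_mem_erase hb', hne⟩
  have hext := hC.exists_extend_by_zero z (by omega) (P := P) (by omega) (by omega) hzero
  obtain ⟨c, hcC, hcP, hc⟩ := hext (fun _ => b) fun _ _ => hb
  obtain ⟨c', hcC', hcP', hc'⟩ := hext (Function.update (fun _ => b) p b') fun x _ => by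
    by_cases hx : x = p
    · simpa [hx] using hb'
    · simpa [hx] using hb
  have heq : c = c' := by
    refine hC.eq_of_agree (K := univ.erase p) ?_ hcC hcC' fun x hx => ?_
    · rw [card_erase_of_mem (mem_univ p), card_univ, Fintype.card_fin]; omega
    · by_cases hxP : x ∈ P
      · rw [hcP x hxP, hcP' x hxP, Function.update_of_ne (ne_of_mem_erase hx)]
      · rw [hc x hxP, hc' x hxP]
  apply hbb'
  rw [← hcP p hp, heq, hcP' p hp, Function.update_self]
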